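/- arXiv:1711.00584 — 2 statements merged into one kernel-verified Lean document; each statement's English description precedes it below -/
import Mathlib

section
/- Let Γ be smooth symmetric connection coefficients on ℝ⁴, let x : ℝ → ℝ⁴ be a geodesic (x''^μ + Γ^μ_{αβ}(x)·x'^α·x'^β = 0 for all λ) and let ξ : ℝ → ℝ⁴ be smooth and satisfy the geodesic deviation equation along x: (∇_λ∇_λξ)^μ = R^μ_{ναβ}(x)·x'^ν·x'^α·ξ^β. For ε ∈ ℝ define the varied curve y(ε,λ) := x(λ) + ε·ξ(λ) and its geodesic defect d^μ(ε,λ) := ∂²_λy^μ + Γ^μ_{αβ}(y)·∂_λy^α·∂_λy^β. Then for every λ and every μ, the function ε ↦ d^μ(ε,λ) vanishes at ε = 0 and has vanishing derivative at ε = 0; in other words, the varied curves remain geodesic up to first order in ε. -/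
open scoped BigOperators

/-- Points of the spacetime manifold ℝ⁴, in coordinates. -/
abbrev Pt : Type := Fin 4 → ℝ

/-- Connection coefficients `Γ^μ_{αβ}` on ℝ⁴. -/
abbrev Conn : Type := Pt → Fin 4 → Fin 4 → Fin 4 → ℝ

/-- Coordinate partial derivative `∂_α f` of a scalar field on ℝ⁴. -/
noncomputable def pd (f : Pt → ℝ) (α : Fin 4) (x : Pt) : ℝ :=
  fderiv ℝ f x (Pi.single α 1)

/-- Curvature tensor `R^μ_{ναβ} = ∂_αΓ^μ_{βν} − ∂_βΓ^μ_{αν} + Γ^μ_{ακ}Γ^κ_{βν} − Γ^μ_{βκ}Γ^κ_{αν}`. -/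
noncomputable def curv (Γ : Conn) (x : Pt) (μ ν α β : Fin 4) : ℝ :=
  pd (fun y => Γ y μ β ν) α x - pd (fun y => Γ y μ α ν) β x
    + ∑ κ, Γ x μ α κ * Γ x κ β ν - ∑ κ, Γ x μ β κ * Γ x κ α ν

/-- Covariant derivative `∇_λ V` of a vector field `V` along a single curve `x`:
`(∇_λ V)^μ = ∂_λ V^μ + Γ^μ_{αβ}(x) x'^α V^β`. -/
noncomputable def covC (Γ : Conn) (x V : ℝ → Pt) : ℝ → Pt :=
  fun l μ => deriv (fun s => V s μ) l
    + ∑ α, ∑ β, Γ (x l) μ α β * deriv (fun s => x s α) l * V l β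

/-- The connection coefficients are smooth. -/
def SmoothConn (Γ : Conn) : Prop := ∀ μ α β, ContDiff ℝ (⊤ : ℕ∞) fun x => Γ x μ α β

/-- The connection coefficients are symmetric in the lower indices. -/
def SymmConn (Γ : Conn) : Prop := ∀ x μ α β, Γ x μ α β = Γ x μ β α

/-- The varied curve `y(ε,λ) = x(λ) + ε·ξ(λ)`. -/
noncomputable def vary (x ξ : ℝ → Pt) (ε : ℝ) : ℝ → Pt :=
  fun l μ => x l μ + ε * ξ l μ

/-- The geodesic defect `d^μ(ε,λ) = ∂²_λ y^μ + Γ^μ_{αβ}(y) ∂_λy^α ∂_λy^β` of the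
varied curve `y(ε,·) = x + ε·ξ`. -/
noncomputable def defect (Γ : Conn) (x ξ : ℝ → Pt) (ε l : ℝ) (μ : Fin 4) : ℝ :=
  deriv (fun s => deriv (fun t => vary x ξ ε t μ) s) l
    + ∑ α, ∑ β, Γ (vary x ξ ε l) μ α β
        * deriv (fun s => vary x ξ ε s α) l * deriv (fun s => vary x ξ ε s β) l

theorem fderiv_eq_sum_pd (f : Pt → ℝ) (p v : Pt) :
    fderiv ℝ f p v = ∑ σ, pd f σ p * v σ := by
  conv_lhs => rw [← Finset.univ_sum_single v]
  rw [map_sum]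
  refine Finset.sum_congr rfl fun σ _ => ?_
  have h : (Pi.single σ (v σ) : Pt) = v σ • Pi.single σ 1 := by
    rw [← Pi.single_smul, smul_eq_mul, mul_one]
  rw [h, map_smul, smul_eq_mul, mul_comm, pd]

/-- Chain rule for a scalar field along a curve, in coordinates. -/
theorem hasDerivAt_comp_curve {f : Pt → ℝ} (hf : Differentiable ℝ f) {c : ℝ → Pt} {v : Pt}
    {t : ℝ} (hc : ∀ σ, HasDerivAt (fun s => c s σ) (v σ) t) :
    HasDerivAt (fun s => f (c s)) (∑ σ, pd f σ (c t) * v σ) t := by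
  rw [← fderiv_eq_sum_pd]
  exact (hf (c t)).hasFDerivAt.comp_hasDerivAt t (hasDerivAt_pi.2 hc)

theorem pd_symm {Γ : Conn} (hΓ : SymmConn Γ) (p : Pt) (σ μ α β : Fin 4) :
    pd (fun y => Γ y μ α β) σ p = pd (fun y => Γ y μ β α) σ p := by
  simp only [hΓ _ μ α β]

theorem ContDiff.hasDerivAt_deriv_of_top {f : ℝ → ℝ} (hf : ContDiff ℝ (⊤ : ℕ∞) f) (t : ℝ) :
    HasDerivAt f (deriv f t) t :=
  (hf.differentiable (by simp) t).hasDerivAt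

theorem ContDiff.hasDerivAt_deriv_deriv_of_top {f : ℝ → ℝ} (hf : ContDiff ℝ (⊤ : ℕ∞) f)
    (t : ℝ) : HasDerivAt (fun s => deriv f s) (deriv (fun s => deriv f s) t) t :=
  (contDiff_infty_iff_deriv.1 hf).2.hasDerivAt_deriv_of_top t

/-- The second covariant derivative along a curve, in coordinates. -/
theorem covC_covC_apply {Γ : Conn} (hΓs : SmoothConn Γ) {x ξ : ℝ → Pt}
    (hx : ∀ μ, ContDiff ℝ (⊤ : ℕ∞) fun l => x l μ)
    (hξ : ∀ μ, ContDiff ℝ (⊤ : ℕ∞) fun l => ξ l μ) (l : ℝ) (μ : Fin 4) :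
    covC Γ x (covC Γ x ξ) l μ = deriv (fun s => deriv (fun t => ξ t μ) s) l
      + ∑ α, ∑ β, (((∑ σ, pd (fun y => Γ y μ α β) σ (x l) * deriv (fun s => x s σ) l)
              * deriv (fun s => x s α) l
            + Γ (x l) μ α β * deriv (fun s => deriv (fun t => x t α) s) l) * ξ l β
          + Γ (x l) μ α β * deriv (fun s => x s α) l * deriv (fun s => ξ s β) l)
      + ∑ α, ∑ β, Γ (x l) μ α β * deriv (fun s => x s α) l * (deriv (fun s => ξ s β) l
          + ∑ γ, ∑ δ, Γ (x l) β γ δ * deriv (fun s => x s γ) l * ξ l δ) := by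
  have h : HasDerivAt (fun s => covC Γ x ξ s μ) _ l :=
    ((hξ μ).hasDerivAt_deriv_deriv_of_top l).add
      (HasDerivAt.fun_sum (u := Finset.univ) fun α _ =>
        HasDerivAt.fun_sum (u := Finset.univ) fun β _ =>
          ((hasDerivAt_comp_curve ((hΓs μ α β).differentiable (by simp))
            fun σ => (hx σ).hasDerivAt_deriv_of_top l).mul
            ((hx α).hasDerivAt_deriv_deriv_of_top l)).mul ((hξ β).hasDerivAt_deriv_of_top l))
  rw [covC, h.deriv]
  rfl

/-- The `ε`-derivative at `ε = 0` of the geodesic defect, in coordinates. -/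
theorem hasDerivAt_defect {Γ : Conn} (hΓs : SmoothConn Γ) {x ξ : ℝ → Pt}
    (hx : ∀ μ, ContDiff ℝ (⊤ : ℕ∞) fun l => x l μ)
    (hξ : ∀ μ, ContDiff ℝ (⊤ : ℕ∞) fun l => ξ l μ) (l : ℝ) (μ : Fin 4) :
    HasDerivAt (fun ε => defect Γ x ξ ε l μ)
      (deriv (fun s => deriv (fun t => ξ t μ) s) l
        + ∑ α, ∑ β, (((∑ σ, pd (fun y => Γ y μ α β) σ (x l) * ξ l σ)
              * deriv (fun s => x s α) l
            + Γ (x l) μ α β * deriv (fun s => ξ s α) l) * deriv (fun s => x s β) l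
          + Γ (x l) μ α β * deriv (fun s => x s α) l * deriv (fun s => ξ s β) l)) 0 := by
  have hd (ε s : ℝ) (ν : Fin 4) : deriv (fun t => vary x ξ ε t ν) s
      = deriv (fun t => x t ν) s + ε * deriv (fun t => ξ t ν) s :=
    (((hx ν).hasDerivAt_deriv_of_top s).add
      (((hξ ν).hasDerivAt_deriv_of_top s).const_mul ε)).deriv
  have hdd (ε : ℝ) : deriv (fun s => deriv (fun t => vary x ξ ε t μ) s) l
      = deriv (fun s => deriv (fun t => x t μ) s) l
        + ε * deriv (fun s => deriv (fun t => ξ t μ) s) l := by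
    simp only [hd]
    exact (((hx μ).hasDerivAt_deriv_deriv_of_top l).add
      (((hξ μ).hasDerivAt_deriv_deriv_of_top l).const_mul ε)).deriv
  have affine (a b : ℝ) : HasDerivAt (fun ε : ℝ => a + ε * b) b 0 := by
    simpa using ((hasDerivAt_id (0 : ℝ)).mul_const b).const_add a
  have h0 : vary x ξ 0 l = x l := by
    funext ν
    simp [vary]
  have hΓ (α β : Fin 4) : HasDerivAt (fun ε => Γ (vary x ξ ε l) μ α β)
      (∑ σ, pd (fun y => Γ y μ α β) σ (x l) * ξ l σ) 0 := by
    have := hasDerivAt_comp_curve (c := fun ε => vary x ξ ε l)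
      ((hΓs μ α β).differentiable (by simp)) fun σ => affine (x l σ) (ξ l σ)
    simpa only [h0] using this
  simp only [defect, hdd]
  simp only [hd]
  refine (affine _ _).add (HasDerivAt.fun_sum fun α _ => HasDerivAt.fun_sum fun β _ => ?_)
  simpa only [h0, zero_mul, add_zero, Pi.mul_def] using ((hΓ α β).mul (affine _ _)).mul (affine _ _)

/-- The geodesic and geodesic deviation equations at a point imply the linearised geodesic
equation: here `G`, `D` stand for the connection coefficients and their partial derivatives
(with `D σ α β` the derivative of `G μ α β`), `u`, `a` for the velocity and acceleration of the
curve, and `v`, `w`, `z` for the deviation field and its first two derivatives. -/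
theorem linearised_geodesic_of_deviation {ι : Type*} [Fintype ι] (G : ι → ι → ι → ℝ)
    (D : ι → ι → ι → ℝ) (hG : ∀ μ α β, G μ α β = G μ β α) (hD : ∀ σ α β, D σ α β = D σ β α)
    (u a v w : ι → ℝ) (z : ℝ) (μ : ι) (ha : ∀ α, a α + ∑ γ, ∑ δ, G α γ δ * u γ * u δ = 0)
    (hdev : z + ∑ α, ∑ β, (((∑ σ, D σ α β * u σ) * u α + G μ α β * a α) * v β
          + G μ α β * u α * w β)
        + ∑ α, ∑ β, G μ α β * u α * (w β + ∑ γ, ∑ δ, G β γ δ * u γ * v δ)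
      = ∑ ν, ∑ α, ∑ β, (D α β ν - D β α ν + ∑ κ, G μ α κ * G κ β ν - ∑ κ, G μ β κ * G κ α ν)
          * u ν * u α * v β) :
    z + ∑ α, ∑ β, (((∑ σ, D σ α β * v σ) * u α + G μ α β * w α) * u β
        + G μ α β * u α * w β) = 0 := by
  have hw : ∑ α, ∑ β, G μ α β * w α * u β = ∑ α, ∑ β, G μ α β * u α * w β := by
    rw [Finset.sum_comm]
    refine Finset.sum_congr rfl fun α _ => Finset.sum_congr rfl fun β _ => ?_
    rw [hG μ β α]; ring
  have hDu : ∑ α, ∑ β, (∑ σ, D σ α β * u σ) * u α * v β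
      = ∑ ν, ∑ α, ∑ β, D α β ν * u ν * u α * v β := by
    refine Finset.sum_congr rfl fun ν _ => ?_
    simp only [Finset.sum_mul]
    rw [Finset.sum_comm]
    refine Finset.sum_congr rfl fun α _ => Finset.sum_congr rfl fun β _ => ?_
    rw [hD α ν β]; ring
  have hDv : ∑ α, ∑ β, (∑ σ, D σ α β * v σ) * u α * u β
      = ∑ ν, ∑ α, ∑ β, D β α ν * u ν * u α * v β := by
    rw [Finset.sum_comm]
    simp only [Finset.sum_mul]
    refine Finset.sum_congr rfl fun ν _ => Finset.sum_congr rfl fun α _ =>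
      Finset.sum_congr rfl fun β _ => ?_
    ring
  have hacc : ∑ α, ∑ β, G μ α β * a α * v β
      = -∑ ν, ∑ α, ∑ β, (∑ κ, G μ β κ * G κ α ν) * u ν * u α * v β := by
    have ha' (α : ι) : a α = -∑ γ, ∑ δ, G α γ δ * u γ * u δ := eq_neg_of_add_eq_zero_left (ha α)
    simp only [ha', mul_neg, neg_mul, Finset.sum_neg_distrib, Finset.mul_sum, Finset.sum_mul,
      neg_inj]
    calc ∑ κ, ∑ β, ∑ α, ∑ ν, G μ κ β * (G κ α ν * u α * u ν) * v β
        = ∑ β, ∑ α, ∑ ν, ∑ κ, G μ κ β * (G κ α ν * u α * u ν) * v β := by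
          rw [Finset.sum_comm]
          refine Finset.sum_congr rfl fun β _ => ?_
          rw [Finset.sum_comm]
          exact Finset.sum_congr rfl fun α _ => Finset.sum_comm
      _ = ∑ α, ∑ ν, ∑ β, ∑ κ, G μ κ β * (G κ α ν * u α * u ν) * v β := by
          rw [Finset.sum_comm]
          exact Finset.sum_congr rfl fun α _ => Finset.sum_comm
      _ = _ := by
          rw [Finset.sum_comm]
          refine Finset.sum_congr rfl fun ν _ => Finset.sum_congr rfl fun α _ =>
            Finset.sum_congr rfl fun β _ => Finset.sum_congr rfl fun κ _ => ?_
          rw [hG μ κ β]; ring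
  have hGG : ∑ α, ∑ β, G μ α β * u α * (∑ γ, ∑ δ, G β γ δ * u γ * v δ)
      = ∑ ν, ∑ α, ∑ β, (∑ κ, G μ α κ * G κ β ν) * u ν * u α * v β := by
    simp only [Finset.mul_sum, Finset.sum_mul]
    rw [Finset.sum_comm (s := Finset.univ (α := ι)) (t := Finset.univ (α := ι))
      (f := fun ν α => ∑ β, ∑ κ, G μ α κ * G κ β ν * u ν * u α * v β)]
    refine Finset.sum_congr rfl fun α _ => ?_
    rw [Finset.sum_comm]
    refine Finset.sum_congr rfl fun ν _ => ?_
    rw [Finset.sum_comm]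
    refine Finset.sum_congr rfl fun β _ => Finset.sum_congr rfl fun κ _ => ?_
    rw [hG κ ν β]; ring
  simp only [add_mul, sub_mul, mul_add, Finset.sum_add_distrib, Finset.sum_sub_distrib]
    at hdev ⊢
  linarith

/-- if `x` is a geodesic of a smooth symmetric connection `Γ` and `ξ`
satisfies the geodesic deviation equation along `x`, then the geodesic defect of the
varied curves `y(ε,·) = x + ε·ξ` vanishes at `ε = 0` together with its first
`ε`-derivative: the varied curves remain geodesic up to first order in `ε`. -/
theorem varied_curves_geodesic_to_first_order
    (Γ : Conn) (hΓs : SmoothConn Γ) (hΓsym : SymmConn Γ)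
    (x : ℝ → Pt) (hx : ∀ μ, ContDiff ℝ (⊤ : ℕ∞) fun l => x l μ)
    (hgeo : ∀ l μ, deriv (fun s => deriv (fun t => x t μ) s) l
        + ∑ α, ∑ β, Γ (x l) μ α β * deriv (fun s => x s α) l * deriv (fun s => x s β) l = 0)
    (ξ : ℝ → Pt) (hξ : ∀ μ, ContDiff ℝ (⊤ : ℕ∞) fun l => ξ l μ)
    (hGDE : ∀ l μ, covC Γ x (covC Γ x ξ) l μ
        = ∑ ν, ∑ α, ∑ β, curv Γ (x l) μ ν α β * deriv (fun s => x s ν) l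
            * deriv (fun s => x s α) l * ξ l β) :
    ∀ l μ, defect Γ x ξ 0 l μ = 0 ∧ deriv (fun ε => defect Γ x ξ ε l μ) 0 = 0 := by
  intro l μ
  have h0 : vary x ξ 0 = x := by
    funext s ν
    simp [vary]
  refine ⟨by simpa only [defect, h0] using hgeo l μ, ?_⟩
  rw [(hasDerivAt_defect hΓs hx hξ l μ).deriv]
  have hdev := hGDE l μ
  rw [covC_covC_apply hΓs hx hξ] at hdev
  exact linearised_geodesic_of_deviation (Γ (x l)) (fun σ α β => pd (fun y => Γ y μ α β) σ (x l))
    (hΓsym (x l)) (fun σ α β => pd_symm hΓsym (x l) σ μ α β) _ _ _ _ _ μ (hgeo l) hdev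
end

section
/- Let u, v ∈ ℝ⁴ with η(u,u) = η(v,v) = −1 and let p ∈ ℝ⁴ be nonzero and null (η(p,p) = 0). Let e₁, e₂ ∈ ℝ⁴ be a Sachs basis for u, i.e. η(e_A, e_B) = δ_{AB}, η(e_A, u) = 0 and η(e_A, p) = 0 for A, B ∈ {1,2}, and let f₁, f₂ ∈ ℝ⁴ be a Sachs basis for v (η(f_A, f_B) = δ_{AB}, η(f_A, v) = 0, η(f_A, p) = 0). Then the 2×2 matrix R with entries R_{AB} := η(f_A, e_B) is an orthogonal matrix, and there exist c₁, c₂ ∈ ℝ such that f_A = R_{A1}·e₁ + R_{A2}·e₂ + c_A·p for A = 1, 2; i.e. the two Sachs bases differ by an O(2) rotation and multiples of p. -/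
/-- The Minkowski bilinear form on ℝ⁴: `η(x,y) = −x₀y₀ + x₁y₁ + x₂y₂ + x₃y₃`. -/
def eta (x y : Fin 4 → ℝ) : ℝ :=
  -(x 0 * y 0) + x 1 * y 1 + x 2 * y 2 + x 3 * y 3

theorem eta_comm (x y : Fin 4 → ℝ) : eta x y = eta y x := by
  unfold eta; ring

theorem eta_add_left (x y z : Fin 4 → ℝ) : eta (x + y) z = eta x z + eta y z := by
  simp only [eta, Pi.add_apply]; ring

theorem eta_sub_left (x y z : Fin 4 → ℝ) : eta (x - y) z = eta x z - eta y z := by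
  simp only [eta, Pi.sub_apply]; ring

theorem eta_smul_left (a : ℝ) (x z : Fin 4 → ℝ) : eta (a • x) z = a * eta x z := by
  simp only [eta, Pi.smul_apply, smul_eq_mul]; ring

theorem eta_zero_left (z : Fin 4 → ℝ) : eta 0 z = 0 := by
  simp [eta]

theorem eq_zero_of_forall_eta_eq_zero {z : Fin 4 → ℝ} (h : ∀ y, eta y z = 0) : z = 0 := by
  ext i
  have hi := h (Pi.single i 1)
  fin_cases i <;> simpa [eta, Pi.single_apply] using hi

/-- A timelike vector is never orthogonal to a nonzero null vector. -/
theorem eta_timelike_null_ne_zero {u p : Fin 4 → ℝ} (hu : eta u u = -1) (hp : p ≠ 0)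
    (hnull : eta p p = 0) : eta u p ≠ 0 := by
  intro h
  unfold eta at hu hnull h
  have hcs : (u 1 * p 1 + u 2 * p 2 + u 3 * p 3) ^ 2 ≤
      (u 1 ^ 2 + u 2 ^ 2 + u 3 ^ 2) * (p 1 ^ 2 + p 2 ^ 2 + p 3 ^ 2) := by
    nlinarith [sq_nonneg (u 1 * p 2 - u 2 * p 1), sq_nonneg (u 1 * p 3 - u 3 * p 1),
      sq_nonneg (u 2 * p 3 - u 3 * p 2)]
  have h₁ : u 1 * p 1 + u 2 * p 2 + u 3 * p 3 = u 0 * p 0 := by linarith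
  have h₂ : u 1 ^ 2 + u 2 ^ 2 + u 3 ^ 2 = u 0 ^ 2 - 1 := by linarith
  have h₃ : p 1 ^ 2 + p 2 ^ 2 + p 3 ^ 2 = p 0 ^ 2 := by linarith
  rw [h₁, h₂, h₃] at hcs
  have h0 : p 0 ^ 2 = 0 := le_antisymm (by linarith) (sq_nonneg _)
  apply hp
  ext i
  have hi : p i ^ 2 = 0 := by
    fin_cases i
    · exact h0
    all_goals
      refine le_antisymm ?_ (sq_nonneg _)
      simp only [Fin.reduceFinMk]
      nlinarith [sq_nonneg (p 1), sq_nonneg (p 2), sq_nonneg (p 3)]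
  simpa using hi

/-- A vector orthogonal to a nonzero null vector `p` and to a Sachs basis adapted to `p` is a
multiple of `p`. -/
theorem exists_eq_smul_of_eta_eq_zero {u p w : Fin 4 → ℝ} {e : Fin 2 → Fin 4 → ℝ}
    (hu : eta u u = -1) (hp : p ≠ 0) (hnull : eta p p = 0)
    (he : ∀ A B, eta (e A) (e B) = if A = B then 1 else 0)
    (heu : ∀ A, eta (e A) u = 0) (hep : ∀ A, eta (e A) p = 0)
    (hwp : eta w p = 0) (hwe : ∀ A, eta w (e A) = 0) : ∃ c : ℝ, w = c • p := by
  have hup := eta_timelike_null_ne_zero hu hp hnull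
  have hli : LinearIndependent ℝ ![u, p, e 0, e 1] := by
    rw [Fintype.linearIndependent_iff]
    intro g hg
    simp only [Fin.sum_univ_four, Matrix.cons_val] at hg
    have hpair (y : Fin 4 → ℝ) :
        g 0 * eta u y + g 1 * eta p y + g 2 * eta (e 0) y + g 3 * eta (e 1) y = 0 := by
      rw [← eta_zero_left y, ← hg]
      simp only [eta_add_left, eta_smul_left]
    have g0 : g 0 = 0 := by
      have h := hpair p
      simpa [hnull, hep, hup] using h
    have g2 : g 2 = 0 := by
      have h := hpair (e 0)
      simpa [eta_comm u, eta_comm p, heu, hep, he] using h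
    have g3 : g 3 = 0 := by
      have h := hpair (e 1)
      simpa [eta_comm u, eta_comm p, heu, hep, he] using h
    have g1 : g 1 = 0 := by
      simpa [g0, g2, g3, hp] using hg
    intro i
    fin_cases i <;> assumption
  have hspan := hli.span_eq_top_of_card_eq_finrank (by simp)
  refine ⟨eta w u / eta u p, sub_eq_zero.mp (eq_zero_of_forall_eta_eq_zero fun y => ?_)⟩
  have hy : y ∈ Submodule.span ℝ (Set.range ![u, p, e 0, e 1]) := hspan ▸ Submodule.mem_top
  induction hy using Submodule.span_induction with
  | mem x hx =>
    obtain ⟨i, rfl⟩ := hx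
    rw [eta_comm, eta_sub_left, eta_smul_left]
    fin_cases i
    · simp [eta_comm p u, hup]
    · simp [hwp, hnull]
    · simp [hwe, eta_comm p, hep]
    · simp [hwe, eta_comm p, hep]
  | zero => exact eta_zero_left _
  | add x y _ _ hx hy => rw [eta_add_left, hx, hy, add_zero]
  | smul a x _ hx => rw [eta_smul_left, hx, mul_zero]

/-- two Sachs bases `e₁, e₂` (for observer `u`) and `f₁, f₂` (for
observer `v`) adapted to the same nonzero null vector `p` are related by an
orthogonal 2×2 matrix `R_{AB} = η(f_A, e_B)` and multiples of `p`:
`f_A = R_{A1}·e₁ + R_{A2}·e₂ + c_A·p`. -/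
theorem sachs_bases_related_by_rotation
    (u v p : Fin 4 → ℝ) (hu : eta u u = -1) (hv : eta v v = -1)
    (hp : p ≠ 0) (hnull : eta p p = 0)
    (e f : Fin 2 → Fin 4 → ℝ)
    (he : ∀ A B, eta (e A) (e B) = if A = B then 1 else 0)
    (heu : ∀ A, eta (e A) u = 0) (hep : ∀ A, eta (e A) p = 0)
    (hf : ∀ A B, eta (f A) (f B) = if A = B then 1 else 0)
    (hfv : ∀ A, eta (f A) v = 0) (hfp : ∀ A, eta (f A) p = 0) :
    (Matrix.of fun A B => eta (f A) (e B)) ∈ Matrix.orthogonalGroup (Fin 2) ℝ ∧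
    ∃ c : Fin 2 → ℝ, ∀ A,
      f A = eta (f A) (e 0) • e 0 + eta (f A) (e 1) • e 1 + c A • p := by
  have hc (A : Fin 2) : ∃ c : ℝ,
      f A - (eta (f A) (e 0) • e 0 + eta (f A) (e 1) • e 1) = c • p := by
    refine exists_eq_smul_of_eta_eq_zero hu hp hnull he heu hep ?_ fun B => ?_
    · simp [eta_sub_left, eta_add_left, eta_smul_left, hfp, hep]
    · rw [eta_sub_left, eta_add_left, eta_smul_left, eta_smul_left]
      fin_cases B <;> simp [he]
  choose c hc using hc
  have hdecomp (A : Fin 2) :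
      f A = eta (f A) (e 0) • e 0 + eta (f A) (e 1) • e 1 + c A • p := by
    rw [← hc A]; abel
  refine ⟨?_, c, hdecomp⟩
  rw [Matrix.mem_orthogonalGroup_iff]
  ext A B
  have h := hf A B
  nth_rewrite 1 [hdecomp A] at h
  rw [eta_add_left, eta_add_left, eta_smul_left, eta_smul_left, eta_smul_left, eta_comm p,
    hfp, eta_comm (e 0) (f B), eta_comm (e 1) (f B)] at h
  simpa [Matrix.mul_apply, Matrix.star_apply, Fin.sum_univ_two, Matrix.one_apply] using h
end
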